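/- (Theorem 3, finite-sample Tukey median under oblivious TV corruption) There exists a universal constant C > 0 with the following property. Let d ≥ 1, let p* be a Borel probability measure on ℝ^d that is halfspace-symmetric with center μ* and has decay function h, let p be a Borel probability measure with TV(p, p*) ≤ ε, let δ ∈ (0, 1), and let X₁, …, Xₙ be i.i.d. samples from p with empirical measure p̂ₙ = (1/n)∑_{i=1}^n δ_{X_i}. Set ε̃ = ε + C·√((d + 1 + log(1/δ))/n). Then with probability at least 1 − δ, every Tukey median μ̂ of p̂ₙ satisfies: for every t ≥ 0 with h(t) < 1 − h(0) − 2ε̃, ‖μ̂ − μ*‖ ≤ t. -/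

import Mathlib

open MeasureTheory
open scoped RealInnerProductSpace ENNReal

noncomputable section

abbrev Euc (d : ℕ) := EuclideanSpace ℝ (Fin d)

/-- Tukey depth of a point `μ` w.r.t. a measure `p`: the infimum over nonzero
directions `v` of the mass of the halfspace `{x | ⟪v, x - μ⟫ ≥ 0}`. -/
def tukeyDepth {d : ℕ} (μ : Euc d) (p : Measure (Euc d)) : ℝ :=
  ⨅ v : {v : Euc d // v ≠ 0}, (p {x | 0 ≤ ⟪(v : Euc d), x - μ⟫}).toReal

/-- `x` is a Tukey median of `p` if it maximizes the Tukey depth. -/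
def IsTukeyMedian {d : ℕ} (x : Euc d) (p : Measure (Euc d)) : Prop :=
  ∀ y : Euc d, tukeyDepth y p ≤ tukeyDepth x p

/-- Total variation distance: supremum over Borel sets `A` of `p A - q A`. -/
def tvDist {d : ℕ} (p q : Measure (Euc d)) : ℝ :=
  ⨆ A : {A : Set (Euc d) // MeasurableSet A}, ((p A).toReal - (q A).toReal)

/-- The halfspace metric `TV~(p, q)`. -/
def halfspaceDist {d : ℕ} (p q : Measure (Euc d)) : ℝ :=
  ⨆ vt : Euc d × ℝ,
    |(p {x | vt.2 ≤ ⟪vt.1, x⟫}).toReal - (q {x | vt.2 ≤ ⟪vt.1, x⟫}).toReal|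

/-- Halfspace symmetry around `μ`: every one-dimensional projection of `X - μ`
is symmetric in distribution. -/
def IsHalfspaceSymmetric {d : ℕ} (p : Measure (Euc d)) (μ : Euc d) : Prop :=
  ∀ v : Euc d,
    p.map (fun x => ⟪v, x - μ⟫) = p.map (fun x => -⟪v, x - μ⟫)

/-- Decay function `h(t)` of a measure `p` centered at `μ`. -/
def decay {d : ℕ} (p : Measure (Euc d)) (μ : Euc d) (t : ℝ) : ℝ :=
  ⨆ v : {v : Euc d // ‖v‖ ≤ 1}, (p {x | t < ⟪(v : Euc d), x - μ⟫}).toReal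

/-- The sign `±1` encoded by a Boolean. -/
def boolSign (b : Bool) : ℝ := if b then 1 else -1

/-- The value at the set `s` of the Rademacher process with signs `σ`. -/
def signSum {α : Type*} (σ : α → Bool) (s : Finset α) : ℝ := ∑ i ∈ s, boolSign (σ i)

lemma sum_exp_boolSign_le {α : Type*} [Fintype α] [DecidableEq α] (a : α → ℝ) :
    ∑ σ : α → Bool, Real.exp (∑ i, boolSign (σ i) * a i)
      ≤ 2 ^ Fintype.card α * Real.exp ((∑ i, a i ^ 2) / 2) := by
  have h := Finset.prod_univ_sum (fun _ : α => (Finset.univ : Finset Bool))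
    (fun i b => Real.exp (boolSign b * a i))
  rw [Fintype.piFinset_univ] at h
  simp_rw [Real.exp_sum]
  rw [← h, Finset.sum_div, Real.exp_sum, ← Finset.card_univ, ← Finset.prod_const,
    ← Finset.prod_mul_distrib]
  refine Finset.prod_le_prod (fun i _ => by positivity) (fun i _ => ?_)
  have := Real.cosh_le_exp_half_sq (a i)
  rw [Real.cosh_eq] at this
  simp only [Fintype.sum_bool, boolSign]
  norm_num
  linarith

lemma sum_exp_signSum_sub_le {α : Type*} [Fintype α] [DecidableEq α] (r : ℝ)
    (s t : Finset α) :
    ∑ σ : α → Bool, Real.exp (r * (signSum σ s - signSum σ t))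
      ≤ 2 ^ Fintype.card α * Real.exp (r ^ 2 * (symmDiff s t).card / 2) := by
  have h := sum_exp_boolSign_le
    (fun i : α => r * ((if i ∈ s then 1 else 0) - (if i ∈ t then 1 else 0)))
  convert h using 4 with σ
  · simp only [signSum, mul_sub, Finset.sum_sub_distrib, Finset.mul_sum]
    congr 1
    · simp [Finset.sum_ite_mem, mul_comm]
    · simp [Finset.sum_ite_mem, mul_comm]
  · have hi : ∀ i, (r * ((if i ∈ s then 1 else 0) - (if i ∈ t then 1 else 0))) ^ 2
        = if i ∈ symmDiff s t then r ^ 2 else 0 := by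
      intro i
      by_cases h1 : i ∈ s <;> by_cases h2 : i ∈ t <;> simp [h1, h2, Finset.mem_symmDiff]
    simp_rw [hi]
    simp [Finset.sum_ite_mem, mul_comm]

lemma sum_choose_le_inv_pow_mul_exp (D m : ℕ) {x : ℝ} (hx : 0 < x) (hx1 : x ≤ 1) :
    ∑ k ≤ D, (m.choose k : ℝ) ≤ x⁻¹ ^ D * Real.exp (x * m) := by
  have h1 : ∑ k ≤ D, (m.choose k : ℝ) * x ^ D ≤ (1 + x) ^ m := by
    calc ∑ k ≤ D, (m.choose k : ℝ) * x ^ D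
        ≤ ∑ k ≤ D, (m.choose k : ℝ) * x ^ k := by
          refine Finset.sum_le_sum fun k hk => ?_
          exact mul_le_mul_of_nonneg_left
            (pow_le_pow_of_le_one hx.le hx1 (Finset.mem_Iic.1 hk)) (by positivity)
      _ ≤ ∑ k ∈ Finset.range (m + 1 + D), (m.choose k : ℝ) * x ^ k := by
          refine Finset.sum_le_sum_of_subset_of_nonneg ?_ (fun _ _ _ => by positivity)
          intro k hk
          simp only [Finset.mem_Iic] at hk
          simp only [Finset.mem_range]; omega
      _ = ∑ k ∈ Finset.range (m + 1), (m.choose k : ℝ) * x ^ k := by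
          symm
          refine Finset.sum_subset (fun k hk => ?_) (fun k _ hk => ?_)
          · simp only [Finset.mem_range] at hk ⊢; omega
          · simp only [Finset.mem_range, not_lt] at hk
            rw [Nat.choose_eq_zero_of_lt (by omega)]; simp
      _ = (1 + x) ^ m := by
          rw [add_comm 1 x, add_pow]
          exact Finset.sum_congr rfl fun k _ => by simp [mul_comm]
  have h2 : (1 + x) ^ m ≤ Real.exp (x * m) := by
    rw [mul_comm, Real.exp_nat_mul]
    exact pow_le_pow_left₀ (by positivity) (by linarith [Real.add_one_le_exp x]) _
  rw [← Finset.sum_mul] at h1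
  rw [inv_pow, ← div_eq_inv_mul, le_div_iff₀ (by positivity)]
  linarith

/-- A family of sets shattering only sets of size at most `D` and whose members are pairwise
separated by more than an `ε`-fraction of the points has at most `(8 / ε) ^ (2 * D)` members. -/
lemma card_le_of_separated_of_shatters {α : Type*} [Fintype α] [DecidableEq α]
    (P : Finset (Finset α)) {D : ℕ} (hD : 1 ≤ D) (hP : ∀ B, P.Shatters B → B.card ≤ D)
    {ε : ℝ} (hε : 0 < ε) (hε1 : ε ≤ 1)
    (hsep : ∀ s ∈ P, ∀ t ∈ P, s ≠ t → ε * Fintype.card α < (symmDiff s t).card) :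
    (P.card : ℝ) ≤ (8 / ε) ^ (2 * D) := by
  classical
  have h8 : 1 ≤ 8 / ε := by rw [le_div_iff₀ hε]; linarith
  rcases Nat.lt_or_ge P.card 2 with hc | hc
  · have : (P.card : ℝ) ≤ 1 := by exact_mod_cast Nat.lt_succ_iff.1 hc
    exact this.trans (one_le_pow₀ h8)
  have hN1 : (1 : ℝ) < P.card := by exact_mod_cast hc
  set l := Real.log P.card with hl
  have hl0 : 0 < l := Real.log_pos hN1
  set m := ⌊2 * l / ε⌋₊ + 1 with hm
  have hm1 : 2 * l < ε * m := by
    have := Nat.lt_floor_add_one (2 * l / ε)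
    rw [div_lt_iff₀ hε] at this
    rw [hm]; push_cast; linarith
  have hm2 : ε * m ≤ 2 * l + ε := by
    have := Nat.floor_le (show 0 ≤ 2 * l / ε by positivity)
    rw [le_div_iff₀ hε] at this
    rw [hm]; push_cast; linarith
  have hn : 0 < Fintype.card α := by
    rw [Fintype.card_pos_iff]
    by_contra hne
    rw [not_nonempty_iff] at hne
    have : P.card ≤ 1 := Finset.card_le_one.2 fun a _ b _ => Subsingleton.elim a b
    omega
  -- a sequence of `m` points distinguishing all members of `P`
  obtain ⟨f, hf⟩ : ∃ f : Fin m → α, ∀ s ∈ P, ∀ t ∈ P, s ≠ t → ∃ j, f j ∈ symmDiff s t := by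
    by_contra hcon
    push Not at hcon
    have hcov : (Finset.univ : Finset (Fin m → α)) ⊆ P.offDiag.biUnion
        (fun q => Fintype.piFinset fun _ : Fin m => (symmDiff q.1 q.2)ᶜ) := by
      intro f _
      obtain ⟨s, hs, t, ht, hst, h⟩ := hcon f
      simp only [Finset.mem_biUnion, Finset.mem_offDiag, Fintype.mem_piFinset, Finset.mem_compl]
      exact ⟨(s, t), ⟨hs, ht, hst⟩, h⟩
    have h1 := (Finset.card_le_card hcov).trans Finset.card_biUnion_le
    have h2 : ∀ q ∈ P.offDiag,
        ((Fintype.piFinset fun _ : Fin m => (symmDiff q.1 q.2)ᶜ).card : ℝ)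
          ≤ ((1 - ε) * Fintype.card α) ^ m := by
      intro q hq
      rw [Finset.mem_offDiag] at hq
      rw [Fintype.card_piFinset_const, Nat.cast_pow]
      refine pow_le_pow_left₀ (by positivity) ?_ _
      rw [Finset.card_compl, Nat.cast_sub (Finset.card_le_univ _)]
      have := hsep _ hq.1 _ hq.2.1 hq.2.2
      linarith
    have h3 : ((Fintype.card α : ℝ)) ^ m
        ≤ (P.card : ℝ) ^ 2 * ((1 - ε) * Fintype.card α) ^ m := by
      have h4 : ((Fintype.card α : ℝ)) ^ m ≤ ∑ q ∈ P.offDiag,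
          ((Fintype.piFinset fun _ : Fin m => (symmDiff q.1 q.2)ᶜ).card : ℝ) := by
        rw [Finset.card_univ, Fintype.card_fun, Fintype.card_fin] at h1
        exact_mod_cast h1
      refine h4.trans ((Finset.sum_le_card_nsmul _ _ _ h2).trans ?_)
      rw [nsmul_eq_mul]
      refine mul_le_mul_of_nonneg_right ?_ ?_
      · rw [Finset.offDiag_card, sq]
        exact_mod_cast Nat.sub_le _ _
      · have : 0 ≤ 1 - ε := by linarith
        positivity
    have h5 : (1 - ε) ^ m ≤ Real.exp (-(ε * m)) := by
      rw [← neg_mul, mul_comm, Real.exp_nat_mul]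
      exact pow_le_pow_left₀ (by linarith) (by linarith [Real.add_one_le_exp (-ε)]) _
    have h6 : (P.card : ℝ) ^ 2 = Real.exp (2 * l) := by
      rw [two_mul, Real.exp_add, hl, Real.exp_log (by linarith), sq]
    have h7 : Real.exp (2 * l) * Real.exp (-(ε * m)) < 1 := by
      rw [← Real.exp_add, Real.exp_lt_one_iff]; linarith
    have h9 : (0 : ℝ) < (Fintype.card α : ℝ) ^ m := by positivity
    rw [mul_pow, h6, ← mul_assoc] at h3
    have h10 : Real.exp (2 * l) * (1 - ε) ^ m < 1 :=
      (mul_le_mul_of_nonneg_left h5 (Real.exp_pos _).le).trans_lt h7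
    nlinarith
  set tr : Finset α → Finset (Fin m) := fun s => Finset.univ.filter fun j => f j ∈ s with htr
  have hinj : Set.InjOn tr P := by
    intro s hs t ht hst
    by_contra hne
    obtain ⟨j, hj⟩ := hf s hs t ht hne
    have : j ∈ tr s ↔ j ∈ tr t := by rw [hst]
    simp only [htr, Finset.mem_filter, Finset.mem_univ, true_and] at this
    rw [Finset.mem_symmDiff] at hj
    tauto
  have hvc : (P.image tr).vcDim ≤ D := by
    refine Finset.sup_le fun B hB => ?_
    rw [Finset.mem_shatterer] at hB
    have hBinj : Set.InjOn f B := by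
      intro i hi j hj hij
      by_contra hne
      obtain ⟨u, hu, hu2⟩ := hB (Finset.singleton_subset_iff.2 hi)
      obtain ⟨s, -, rfl⟩ := Finset.mem_image.1 hu
      have hi' : i ∈ B ∩ tr s := by rw [hu2]; simp
      have hj' : j ∉ B ∩ tr s := by rw [hu2]; simpa using fun h => hne h.symm
      simp only [htr, Finset.mem_inter, Finset.mem_filter, Finset.mem_univ, true_and] at hi' hj'
      rw [hij] at hi'
      exact hj' ⟨hj, hi'.2⟩
    rw [← Finset.card_image_of_injOn hBinj]
    refine hP _ fun S hS => ?_
    obtain ⟨u, hu, hu2⟩ := hB (Finset.filter_subset (fun j => f j ∈ S) B)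
    obtain ⟨s, hs, rfl⟩ := Finset.mem_image.1 hu
    refine ⟨s, hs, ?_⟩
    ext a
    have key : ∀ j ∈ B, (f j ∈ s ↔ f j ∈ S) := by
      intro j hj
      have : j ∈ B ∩ tr s ↔ j ∈ B.filter fun j => f j ∈ S := by rw [hu2]
      simpa [htr, hj] using this
    simp only [Finset.mem_inter, Finset.mem_image]
    constructor
    · rintro ⟨⟨j, hj, rfl⟩, ha⟩
      exact (key j hj).1 ha
    · intro ha
      obtain ⟨j, hj, rfl⟩ := Finset.mem_image.1 (hS ha)
      exact ⟨⟨j, hj, rfl⟩, (key j hj).2 ha⟩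
  have hcard : (P.card : ℝ) ≤ ∑ k ≤ D, (m.choose k : ℝ) := by
    rw [← Finset.card_image_of_injOn hinj]
    have h1 := (P.image tr).card_le_card_shatterer.trans Finset.card_shatterer_le_sum_vcDim
    rw [Fintype.card_fin] at h1
    have h2 : ∑ k ≤ (P.image tr).vcDim, m.choose k ≤ ∑ k ≤ D, m.choose k :=
      Finset.sum_le_sum_of_subset (Finset.Iic_subset_Iic.2 hvc)
    exact_mod_cast h1.trans h2
  have hx := hcard.trans (sum_choose_le_inv_pow_mul_exp D m (x := ε / 8) (by positivity)
    (by linarith))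
  rw [inv_div] at hx
  have hlog : l ≤ D * Real.log (8 / ε) + ε / 8 * m := by
    have := Real.log_le_log (by linarith) hx
    rwa [Real.log_mul (by positivity) (Real.exp_ne_zero _), Real.log_exp, Real.log_pow] at this
  have hlog8 : 1 ≤ Real.log (8 / ε) := by
    rw [Real.le_log_iff_exp_le (by positivity)]
    refine Real.exp_one_lt_d9.le.trans ?_
    rw [le_div_iff₀ hε]; linarith
  have hD' : (1 : ℝ) ≤ D := by exact_mod_cast hD
  have hfin : l ≤ (2 * D : ℕ) * Real.log (8 / ε) := by
    push_cast
    nlinarith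
  rw [← Real.log_pow] at hfin
  exact (Real.log_le_log_iff (by linarith) (by positivity)).1 hfin

/-- A Hamming net of a family of sets, given by its projection map. -/
lemma exists_net {α : Type*} [Fintype α] [DecidableEq α]
    (T : Finset (Finset α)) {D : ℕ} (hD : 1 ≤ D) (hT : ∀ B, T.Shatters B → B.card ≤ D)
    {ε : ℝ} (hε : 0 < ε) (hε1 : ε ≤ 1) :
    ∃ c : Finset α → Finset α, ((T.image c).card : ℝ) ≤ (8 / ε) ^ (2 * D) ∧
      ∀ t ∈ T, ((symmDiff t (c t)).card : ℝ) ≤ ε * Fintype.card α := by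
  classical
  let sep : Finset (Finset α) → Prop := fun P =>
    ∀ s ∈ P, ∀ t ∈ P, s ≠ t → ε * Fintype.card α < (symmDiff s t).card
  obtain ⟨P, hPmax⟩ := (T.powerset.filter sep).exists_maximal ⟨∅, by simp [sep]⟩
  have hP := hPmax.prop
  simp only [Finset.mem_filter, Finset.mem_powerset] at hP
  have hex : ∀ t ∈ T, ∃ s ∈ P, ((symmDiff t s).card : ℝ) ≤ ε * Fintype.card α := by
    intro t ht
    by_contra hcon
    push Not at hcon
    have hmem : insert t P ∈ T.powerset.filter sep := by
      simp only [Finset.mem_filter, Finset.mem_powerset]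
      refine ⟨Finset.insert_subset ht hP.1, ?_⟩
      intro a ha b hb hab
      rw [Finset.mem_insert] at ha hb
      rcases ha with rfl | ha <;> rcases hb with rfl | hb
      · exact absurd rfl hab
      · exact hcon b hb
      · rw [symmDiff_comm]; exact hcon a ha
      · exact hP.2 a ha b hb hab
    have htP : t ∈ P := hPmax.le_of_ge hmem (Finset.subset_insert t P) (Finset.mem_insert_self t P)
    have := hcon t htP
    simp only [symmDiff_self, Finset.bot_eq_empty, Finset.card_empty, Nat.cast_zero] at this
    exact absurd this (not_lt.2 (by positivity))
  choose! c hc hc' using hex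
  refine ⟨c, ?_, hc'⟩
  refine le_trans ?_ (card_le_of_separated_of_shatters P hD
    (fun B hB => hT B (hB.mono_left hP.1)) hε hε1 hP.2)
  exact_mod_cast Finset.card_le_card (Finset.image_subset_iff.2 hc)

lemma card_symmDiff_le_add {α : Type*} [DecidableEq α] (s t u : Finset α) :
    (symmDiff s u).card ≤ (symmDiff t s).card + (symmDiff t u).card := by
  rw [symmDiff_comm t s]
  exact (Finset.card_le_card (symmDiff_triangle s t u)).trans (Finset.card_union_le _ _)

lemma exp_sum_mul_le {K : ℕ} {w y a : ℕ → ℝ} (hw : ∀ k, 0 ≤ w k)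
    (hw1 : ∑ k ∈ Finset.range K, w k ≤ 1) :
    Real.exp (∑ k ∈ Finset.range K, w k * y k)
      ≤ Real.exp (∑ k ∈ Finset.range K, w k * a k) *
        ((1 - ∑ k ∈ Finset.range K, w k)
          + ∑ k ∈ Finset.range K, w k * Real.exp (y k - a k)) := by
  have h := convexOn_exp.map_add_sum_le (t := Finset.range K) (w := w) (p := fun k => y k - a k)
    (v := 1 - ∑ k ∈ Finset.range K, w k) (q := 0) (fun k _ => hw k) (by ring)
    (fun _ _ => Set.mem_univ _) (by linarith) (Set.mem_univ _)
  simp only [smul_eq_mul, mul_zero, zero_add, Real.exp_zero, mul_one] at h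
  refine le_trans (le_of_eq ?_) (mul_le_mul_of_nonneg_left h (Real.exp_pos _).le)
  rw [← Real.exp_add, ← Finset.sum_add_distrib]
  congr 1
  exact Finset.sum_congr rfl fun k _ => by ring

/-- Chaining bound for the exponential moments of the Rademacher process indexed by a family of
sets that shatters only sets of size at most `D`. -/
lemma exists_exp_signSum_bound {α : Type*} [Fintype α] [DecidableEq α]
    (T : Finset (Finset α)) {D : ℕ} (hD : 1 ≤ D) (hT : ∀ B, T.Shatters B → B.card ≤ D) (r : ℝ) :
    ∃ B : (α → Bool) → ℝ, (∀ σ, ∀ t ∈ T, Real.exp (r * signSum σ t) ≤ B σ) ∧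
      ∑ σ, B σ ≤ 2 ^ Fintype.card α * Real.exp (20 * D + 4 * r ^ 2 * Fintype.card α) := by
  classical
  set n := Fintype.card α with hn
  have hnet : ∀ k : ℕ, ∃ c : Finset α → Finset α,
      ((T.image c).card : ℝ) ≤ (8 * 4 ^ k) ^ (2 * D) ∧
      (∀ t ∈ T, ((symmDiff t (c t)).card : ℝ) ≤ (1 / 4) ^ k * n) ∧
      (k = 0 → ∀ t, c t = ∅) := by
    intro k
    rcases Nat.eq_zero_or_pos k with rfl | hk
    · refine ⟨fun _ => ∅, ?_, fun t _ => ?_, fun _ _ => rfl⟩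
      · have h1 : (T.image fun _ => (∅ : Finset α)).card ≤ 1 :=
          Finset.card_le_one.2 fun a ha b hb => by
            simp only [Finset.mem_image] at ha hb
            obtain ⟨_, _, rfl⟩ := ha
            obtain ⟨_, _, rfl⟩ := hb
            rfl
        have h2 : ((T.image fun _ => (∅ : Finset α)).card : ℝ) ≤ 1 := by exact_mod_cast h1
        exact h2.trans (one_le_pow₀ (by norm_num))
      · simp only [pow_zero, one_mul]
        exact_mod_cast Finset.card_le_univ _
    · obtain ⟨c, hc1, hc2⟩ := exists_net T hD hT (ε := (1 / 4) ^ k) (by positivity)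
        (pow_le_one₀ (by norm_num) (by norm_num))
      refine ⟨c, ?_, hc2, fun h => by omega⟩
      convert hc1 using 2
      rw [one_div, inv_pow, div_inv_eq_mul]
  choose c hc1 hc2 hc3 using hnet
  set w : ℕ → ℝ := fun k => (1 / 2) ^ (k + 1) with hw
  have hw0 : ∀ k, 0 < w k := fun k => by simp only [hw]; positivity
  set a : ℕ → ℝ := fun k => 4 * D * (2 * k + 5) * Real.log 2 + 4 * r ^ 2 * n with ha
  have hS : ∀ K : ℕ, ∑ k ∈ Finset.range K, w k = 1 - (1 / 2) ^ K := by
    intro K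
    induction K with
    | zero => simp
    | succ K ih => rw [Finset.sum_range_succ, ih, hw]; ring
  have hS2 : ∀ K : ℕ, ∑ k ∈ Finset.range K, w k * (2 * k + 5) = 7 - (2 * K + 7) * (1 / 2) ^ K := by
    intro K
    induction K with
    | zero => simp
    | succ K ih => rw [Finset.sum_range_succ, ih, hw]; push_cast; ring
  have hS1 : ∀ K : ℕ, ∑ k ∈ Finset.range K, w k ≤ 1 := fun K => by
    rw [hS]; linarith [show (0 : ℝ) ≤ (1 / 2) ^ K by positivity]
  have hWa : ∑ k ∈ Finset.range n, w k * a k ≤ 20 * D + 4 * r ^ 2 * n := by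
    have h1 : ∑ k ∈ Finset.range n, w k * a k
        = 4 * D * Real.log 2 * (∑ k ∈ Finset.range n, w k * (2 * k + 5))
          + 4 * r ^ 2 * n * ∑ k ∈ Finset.range n, w k := by
      rw [Finset.mul_sum, Finset.mul_sum, ← Finset.sum_add_distrib]
      exact Finset.sum_congr rfl fun k _ => by simp only [ha]; ring
    have h2 : ∑ k ∈ Finset.range n, w k * (2 * k + 5) ≤ 7 := by
      rw [hS2]; linarith [show (0 : ℝ) ≤ (2 * n + 7) * (1 / 2) ^ n by positivity]
    have h3 : 4 * D * Real.log 2 * (∑ k ∈ Finset.range n, w k * (2 * k + 5))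
        ≤ 4 * D * Real.log 2 * 7 :=
      mul_le_mul_of_nonneg_left h2 (by have := Real.log_nonneg (x := 2) (by norm_num); positivity)
    have h4 : 4 * r ^ 2 * n * ∑ k ∈ Finset.range n, w k ≤ 4 * r ^ 2 * n * 1 :=
      mul_le_mul_of_nonneg_left (hS1 n) (by positivity)
    have h5 : 4 * (D : ℝ) * Real.log 2 * 7 ≤ 20 * D := by
      have := Real.log_two_lt_d9
      have : (0 : ℝ) ≤ D := by positivity
      nlinarith
    linarith
  set L : ℕ → Finset (Finset α × Finset α) := fun k => T.image fun t => (c k t, c (k + 1) t) with hL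
  have hLcard : ∀ k, ((L k).card : ℝ) ≤ Real.exp (4 * D * (2 * k + 5) * Real.log 2) := by
    intro k
    have h1 : L k ⊆ T.image (c k) ×ˢ T.image (c (k + 1)) := by
      intro q hq
      obtain ⟨t, ht, rfl⟩ := Finset.mem_image.1 hq
      exact Finset.mk_mem_product (Finset.mem_image_of_mem _ ht) (Finset.mem_image_of_mem _ ht)
    have h2 : ((L k).card : ℝ) ≤ (T.image (c k)).card * (T.image (c (k + 1))).card := by
      have := Finset.card_le_card h1
      rw [Finset.card_product] at this
      exact_mod_cast this
    have h3 : ((8 : ℝ) * 4 ^ k) ^ (2 * D) ≤ (8 * 4 ^ (k + 1)) ^ (2 * D) := by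
      refine pow_le_pow_left₀ (by positivity) ?_ _
      exact mul_le_mul_of_nonneg_left (pow_le_pow_right₀ (by norm_num) (by omega)) (by norm_num)
    have h4 : ((8 : ℝ) * 4 ^ (k + 1)) ^ (2 * D) * (8 * 4 ^ (k + 1)) ^ (2 * D)
        = Real.exp (4 * D * (2 * k + 5) * Real.log 2) := by
      have h5 : (4 * D * (2 * k + 5) * Real.log 2 : ℝ)
          = ((4 * D * (2 * k + 5) : ℕ) : ℝ) * Real.log 2 := by push_cast; ring
      rw [h5, Real.exp_nat_mul, Real.exp_log (by norm_num)]
      have h8 : (8 : ℝ) = 2 ^ 3 := by norm_num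
      have h4 : (4 : ℝ) = 2 ^ 2 := by norm_num
      rw [h8, h4, ← pow_mul, ← pow_add, ← pow_add, ← pow_mul]
      congr 1
      ring
    rw [← h4]
    exact h2.trans (mul_le_mul ((hc1 k).trans h3) (hc1 (k + 1)) (by positivity) (by positivity))
  have hLdist : ∀ k, ∀ q ∈ L k, ((symmDiff q.2 q.1).card : ℝ) ≤ 2 * (1 / 4) ^ k * n := by
    intro k q hq
    obtain ⟨t, ht, rfl⟩ := Finset.mem_image.1 hq
    have h1 : ((symmDiff (c (k + 1) t) (c k t)).card : ℝ)
        ≤ (symmDiff t (c (k + 1) t)).card + (symmDiff t (c k t)).card := by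
      exact_mod_cast card_symmDiff_le_add _ t _
    have h2 := hc2 k t ht
    have h3 := hc2 (k + 1) t ht
    have h4 : ((1 : ℝ) / 4) ^ (k + 1) * n ≤ (1 / 4) ^ k * n := by
      refine mul_le_mul_of_nonneg_right ?_ (by positivity)
      exact pow_le_pow_of_le_one (by norm_num) (by norm_num) (by omega)
    simp only
    linarith
  have hLsum : ∀ k, ∑ σ : α → Bool, ∑ q ∈ L k,
      Real.exp (r / w k * (signSum σ q.2 - signSum σ q.1) - a k) ≤ 2 ^ n := by
    intro k
    rw [Finset.sum_comm]
    have h1 : ∀ q ∈ L k, ∑ σ : α → Bool,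
        Real.exp (r / w k * (signSum σ q.2 - signSum σ q.1) - a k)
          ≤ 2 ^ n * Real.exp (4 * r ^ 2 * n - a k) := by
      intro q hq
      simp_rw [sub_eq_add_neg _ (a k), Real.exp_add]
      rw [← Finset.sum_mul, ← mul_assoc]
      refine mul_le_mul_of_nonneg_right ?_ (Real.exp_pos _).le
      refine (sum_exp_signSum_sub_le _ _ _).trans ?_
      refine mul_le_mul_of_nonneg_left (Real.exp_le_exp.2 ?_) (by positivity)
      have h2 : (r / w k) ^ 2 * (2 * (1 / 4) ^ k * n) / 2 = 4 * r ^ 2 * n := by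
        have h3 : (w k) ^ 2 = (1 / 4) * (1 / 4) ^ k := by
          simp only [hw]
          rw [← pow_mul, mul_comm, pow_mul]
          norm_num [pow_succ]
          ring
        rw [div_pow, h3]
        field_simp
      rw [← h2]
      have := hLdist k q hq
      gcongr
    refine (Finset.sum_le_card_nsmul _ _ _ h1).trans ?_
    rw [nsmul_eq_mul]
    have h2 : Real.exp (4 * r ^ 2 * n - a k) = (Real.exp (4 * D * (2 * k + 5) * Real.log 2))⁻¹ := by
      rw [← Real.exp_neg]
      congr 1
      simp only [ha]; ring
    rw [h2, mul_left_comm]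
    refine mul_le_of_le_one_right (by positivity) ?_
    rw [← div_eq_mul_inv]
    exact (div_le_one (Real.exp_pos _)).2 (hLcard k)
  refine ⟨fun σ => Real.exp (∑ k ∈ Finset.range n, w k * a k) *
    ((1 - ∑ k ∈ Finset.range n, w k) + ∑ k ∈ Finset.range n, w k *
      ∑ q ∈ L k, Real.exp (r / w k * (signSum σ q.2 - signSum σ q.1) - a k)), ?_, ?_⟩
  · intro σ t ht
    have hlast : c n t = t := by
      have h1 := hc2 n t ht
      have h2 : ((1 : ℝ) / 4) ^ n * n < 1 := by
        rw [one_div, inv_pow, inv_mul_lt_one₀ (by positivity)]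
        exact_mod_cast Nat.lt_pow_self (by norm_num)
      have h3 : (symmDiff t (c n t)).card < 1 := by exact_mod_cast h1.trans_lt h2
      rw [Nat.lt_one_iff, Finset.card_eq_zero, ← Finset.bot_eq_empty, symmDiff_eq_bot] at h3
      exact h3.symm
    have htel : r * signSum σ t = ∑ k ∈ Finset.range n,
        w k * (r / w k * (signSum σ (c (k + 1) t) - signSum σ (c k t))) := by
      rw [Finset.sum_congr (g := fun k => r * (signSum σ (c (k + 1) t) - signSum σ (c k t))) rfl
        (fun k _ => by have := (hw0 k).ne'; field_simp), ← Finset.mul_sum,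
        Finset.sum_range_sub (fun k => signSum σ (c k t)), hlast, hc3 0 rfl]
      simp [signSum]
    rw [htel]
    refine (exp_sum_mul_le (a := a) (fun k => (hw0 k).le) (hS1 n)).trans ?_
    refine mul_le_mul_of_nonneg_left (add_le_add le_rfl (Finset.sum_le_sum fun k _ => ?_))
      (Real.exp_pos _).le
    refine mul_le_mul_of_nonneg_left ?_ (hw0 k).le
    exact Finset.single_le_sum
      (f := fun q : Finset α × Finset α => Real.exp (r / w k * (signSum σ q.2 - signSum σ q.1) - a k))
      (fun _ _ => (Real.exp_pos _).le) (Finset.mem_image_of_mem (fun t => (c k t, c (k + 1) t)) ht)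
  · rw [← Finset.mul_sum, Finset.sum_add_distrib, Finset.sum_const, Finset.sum_comm,
      Finset.card_univ, Fintype.card_fun, Fintype.card_bool, ← hn, nsmul_eq_mul, mul_comm]
    refine mul_le_mul ?_ (Real.exp_le_exp.2 hWa) (Real.exp_pos _).le (by positivity)
    have h1 : ∑ k ∈ Finset.range n, ∑ σ : α → Bool, w k *
        ∑ q ∈ L k, Real.exp (r / w k * (signSum σ q.2 - signSum σ q.1) - a k)
          ≤ ∑ k ∈ Finset.range n, w k * 2 ^ n := by
      refine Finset.sum_le_sum fun k _ => ?_
      rw [← Finset.mul_sum]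
      exact mul_le_mul_of_nonneg_left (hLsum k) (hw0 k).le
    rw [← Finset.sum_mul] at h1
    push_cast
    linarith

/-- A set system `H` shatters at most `D` of the points of any `n`-tuple. -/
def ShattersAtMost {X ι : Type*} (H : ι → Set X) (D n : ℕ) : Prop :=
  ∀ (x : Fin n → X) (B : Finset (Fin n)),
    (∀ S ⊆ B, ∃ j, ∀ i ∈ B, (x i ∈ H j ↔ i ∈ S)) → B.card ≤ D

lemma ShattersAtMost.exists_exp_bound {X ι : Type*} {H : ι → Set X} {D n : ℕ} (hD : 1 ≤ D)
    (hH : ShattersAtMost H D n) (x : Fin n → X) (r : ℝ) :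
    ∃ B : (Fin n → Bool) → ℝ,
      (∀ σ j, Real.exp (r * ∑ i, boolSign (σ i) * (H j).indicator 1 (x i)) ≤ B σ) ∧
      ∑ σ, B σ ≤ 2 ^ n * Real.exp (20 * D + 4 * r ^ 2 * n) := by
  classical
  let tr : ι → Finset (Fin n) := fun j => Finset.univ.filter fun i => x i ∈ H j
  obtain ⟨B, hB, hBs⟩ := exists_exp_signSum_bound
    (Finset.univ.filter fun s : Finset (Fin n) => ∃ j, s = tr j) hD (fun C hC => hH x C
      fun S hS => by
        obtain ⟨u, hu, hu2⟩ := hC hS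
        simp only [Finset.mem_filter, Finset.mem_univ, true_and] at hu
        obtain ⟨j, rfl⟩ := hu
        refine ⟨j, fun i hi => ?_⟩
        rw [← hu2]
        simp [tr, hi]) r
  rw [Fintype.card_fin] at hBs
  refine ⟨B, fun σ j => ?_, hBs⟩
  convert hB σ (tr j) (by simp) using 3
  simp only [signSum, tr, Finset.sum_filter, Set.indicator_apply, Pi.one_apply, mul_ite, mul_one,
    mul_zero]

lemma ShattersAtMost.sum_iSup_exp_le {X ι : Type*} [Nonempty ι] {H : ι → Set X} {D n : ℕ}
    (hD : 1 ≤ D) (hH : ShattersAtMost H D n) (z : Fin n → X × X) (r : ℝ) :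
    ∑ σ : Fin n → Bool, ⨆ j, ENNReal.ofReal (Real.exp (r * ∑ i, boolSign (σ i) *
        ((H j).indicator 1 (z i).1 - (H j).indicator 1 (z i).2)))
      ≤ 2 ^ n * ENNReal.ofReal (Real.exp (20 * D + 16 * r ^ 2 * n)) := by
  obtain ⟨B₁, h₁, s₁⟩ := hH.exists_exp_bound hD (fun i => (z i).1) (2 * r)
  obtain ⟨B₂, h₂, s₂⟩ := hH.exists_exp_bound hD (fun i => (z i).2) (-(2 * r))
  have hnn : ∀ σ, 0 ≤ (B₁ σ + B₂ σ) / 2 := fun σ => by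
    have j := Classical.arbitrary ι
    have := (Real.exp_pos _).le.trans (h₁ σ j)
    have := (Real.exp_pos _).le.trans (h₂ σ j)
    positivity
  calc _ ≤ ∑ σ, ENNReal.ofReal ((B₁ σ + B₂ σ) / 2) := by
        refine Finset.sum_le_sum fun σ _ => iSup_le fun j => ENNReal.ofReal_le_ofReal ?_
        have hc := convexOn_exp.right (Set.mem_univ (2 * r * ∑ i, boolSign (σ i) *
            (H j).indicator 1 (z i).1)) (Set.mem_univ (-(2 * r) * ∑ i, boolSign (σ i) *
            (H j).indicator 1 (z i).2)) (show (0 : ℝ) ≤ 1 / 2 by norm_num)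
            (show (0 : ℝ) ≤ 1 / 2 by norm_num) (by norm_num)
        simp only [smul_eq_mul] at hc
        have he : r * ∑ i, boolSign (σ i) *
              ((H j).indicator 1 (z i).1 - (H j).indicator 1 (z i).2)
            = 1 / 2 * (2 * r * ∑ i, boolSign (σ i) * (H j).indicator 1 (z i).1)
              + 1 / 2 * (-(2 * r) * ∑ i, boolSign (σ i) * (H j).indicator 1 (z i).2) := by
          simp only [mul_sub, Finset.sum_sub_distrib]
          ring
        rw [he]
        have := h₁ σ j
        have := h₂ σ j
        linarith
    _ = ENNReal.ofReal (∑ σ, (B₁ σ + B₂ σ) / 2) :=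
        (ENNReal.ofReal_sum_of_nonneg fun σ _ => hnn σ).symm
    _ ≤ ENNReal.ofReal (2 ^ n * Real.exp (20 * D + 16 * r ^ 2 * n)) := by
        refine ENNReal.ofReal_le_ofReal ?_
        rw [← Finset.sum_div, Finset.sum_add_distrib]
        have e₁ : 4 * (2 * r) ^ 2 * (n : ℝ) = 16 * r ^ 2 * n := by ring
        have e₂ : 4 * (-(2 * r)) ^ 2 * (n : ℝ) = 16 * r ^ 2 * n := by ring
        rw [e₁] at s₁
        rw [e₂] at s₂
        linarith
    _ = _ := by
        rw [ENNReal.ofReal_mul (by positivity), ENNReal.ofReal_pow (by norm_num)]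
        simp

lemma measurable_indicator_one {X : Type*} [MeasurableSpace X] {s : Set X}
    (hs : MeasurableSet s) : Measurable (s.indicator (1 : X → ℝ)) :=
  measurable_one.indicator hs

lemma ShattersAtMost.lintegral_pair_le {X ι : Type*} [MeasurableSpace X] [Nonempty ι] [Countable ι]
    {H : ι → Set X} (hmeas : ∀ j, MeasurableSet (H j)) {D n : ℕ}
    (hD : 1 ≤ D) (hH : ShattersAtMost H D n) (p : Measure X) [IsProbabilityMeasure p] (r : ℝ) :
    ∫⁻ z, ⨆ j, ENNReal.ofReal (Real.exp (r * ∑ i,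
        ((H j).indicator 1 (z i).1 - (H j).indicator 1 (z i).2)))
          ∂(Measure.pi fun _ : Fin n => p.prod p)
      ≤ ENNReal.ofReal (Real.exp (20 * D + 16 * r ^ 2 * n)) := by
  have hm := fun j => measurable_indicator_one (hmeas j)
  have hmeasG : ∀ b : Fin n → ℝ, Measurable fun z : Fin n → X × X =>
      ⨆ j, ENNReal.ofReal (Real.exp (r * ∑ i, b i *
        ((H j).indicator 1 (z i).1 - (H j).indicator 1 (z i).2))) := by
    intro b
    refine Measurable.iSup fun j => ?_
    have := hm j
    fun_prop
  set I := ∫⁻ z, ⨆ j, ENNReal.ofReal (Real.exp (r * ∑ i,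
        ((H j).indicator 1 (z i).1 - (H j).indicator 1 (z i).2)))
          ∂(Measure.pi fun _ : Fin n => p.prod p) with hI
  have hflip : ∀ σ : Fin n → Bool, I = ∫⁻ z, ⨆ j, ENNReal.ofReal (Real.exp (r * ∑ i,
      boolSign (σ i) * ((H j).indicator 1 (z i).1 - (H j).indicator 1 (z i).2)))
          ∂(Measure.pi fun _ : Fin n => p.prod p) := by
    intro σ
    have hmp : MeasurePreserving (fun (z : Fin n → X × X) i => if σ i then z i else (z i).swap)
        (Measure.pi fun _ : Fin n => p.prod p) (Measure.pi fun _ : Fin n => p.prod p) := by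
      refine measurePreserving_pi _ _ (f := fun i (q : X × X) => if σ i then q else q.swap) fun i => ?_
      cases hσ : σ i
      · simpa [hσ] using Measure.measurePreserving_swap
      · simp only [if_true]
        exact MeasurePreserving.id (p.prod p)
    have h1 := hmeasG 1
    simp only [Pi.one_apply, one_mul] at h1
    rw [hI, ← hmp.lintegral_comp h1]
    refine lintegral_congr fun z => iSup_congr fun j => ?_
    congr 3
    refine Finset.sum_congr rfl fun i _ => ?_
    cases hσ : σ i <;> simp [boolSign, hσ]
  have hsum : (2 : ℝ≥0∞) ^ n * I
      ≤ 2 ^ n * ENNReal.ofReal (Real.exp (20 * D + 16 * r ^ 2 * n)) := by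
    calc (2 : ℝ≥0∞) ^ n * I = ∑ σ : Fin n → Bool, I := by simp
      _ = ∑ σ : Fin n → Bool, ∫⁻ z, ⨆ j, ENNReal.ofReal (Real.exp (r * ∑ i,
          boolSign (σ i) * ((H j).indicator 1 (z i).1 - (H j).indicator 1 (z i).2)))
          ∂(Measure.pi fun _ : Fin n => p.prod p) := Finset.sum_congr rfl fun σ _ => hflip σ
      _ = ∫⁻ z, ∑ σ : Fin n → Bool, ⨆ j, ENNReal.ofReal (Real.exp (r * ∑ i,
          boolSign (σ i) * ((H j).indicator 1 (z i).1 - (H j).indicator 1 (z i).2)))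
          ∂(Measure.pi fun _ : Fin n => p.prod p) :=
            (lintegral_finsetSum _ fun σ _ => hmeasG fun i => boolSign (σ i)).symm
      _ ≤ ∫⁻ _, 2 ^ n * ENNReal.ofReal (Real.exp (20 * D + 16 * r ^ 2 * n))
          ∂(Measure.pi fun _ : Fin n => p.prod p) :=
            lintegral_mono fun z => hH.sum_iSup_exp_le hD z r
      _ = _ := by simp
  exact (ENNReal.mul_le_mul_iff_right (by simp) (by simp)).1 hsum

lemma exp_mul_sub_le_lintegral {X : Type*} [MeasurableSpace X] {s : Set X} (hs : MeasurableSet s)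
    (n : ℕ) (p : Measure X) [IsProbabilityMeasure p] (r a : ℝ) :
    ENNReal.ofReal (Real.exp (r * (a - n * p.real s)))
      ≤ ∫⁻ ω, ENNReal.ofReal (Real.exp (r * (a - ∑ i, s.indicator 1 (ω i))))
        ∂(Measure.pi fun _ : Fin n => p) := by
  have hm := measurable_indicator_one hs
  set P := Measure.pi fun _ : Fin n => p
  have hmf : Measurable fun ω : Fin n → X => r * (a - ∑ i, s.indicator 1 (ω i)) := by fun_prop
  have hb : ∀ ω : Fin n → X, |r * (a - ∑ i, s.indicator 1 (ω i))| ≤ |r| * (|a| + n) := by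
    intro ω
    rw [abs_mul]
    refine mul_le_mul_of_nonneg_left ((abs_sub _ _).trans ?_) (abs_nonneg _)
    refine add_le_add le_rfl ((Finset.abs_sum_le_sum_abs _ _).trans ?_)
    refine (Finset.sum_le_card_nsmul _ _ 1 fun i _ => ?_).trans (by simp)
    by_cases h : ω i ∈ s <;> simp [h]
  have hi : Integrable (fun ω : Fin n → X => r * (a - ∑ i, s.indicator 1 (ω i))) P :=
    Integrable.of_bound hmf.aestronglyMeasurable _ (Filter.Eventually.of_forall hb)
  have hie : Integrable (fun ω : Fin n → X =>
      Real.exp (r * (a - ∑ i, s.indicator 1 (ω i)))) P := by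
    refine Integrable.of_bound hmf.exp.aestronglyMeasurable (Real.exp (|r| * (|a| + n)))
      (Filter.Eventually.of_forall fun ω => ?_)
    rw [Real.norm_eq_abs, Real.abs_exp]
    exact Real.exp_le_exp.2 ((le_abs_self _).trans (hb ω))
  have hJ := convexOn_exp.map_integral_le Real.continuous_exp.continuousOn isClosed_univ
    (Filter.Eventually.of_forall fun _ => Set.mem_univ _) hi hie
  have hii : ∀ i : Fin n, Integrable (fun ω : Fin n → X => s.indicator (1 : X → ℝ) (ω i)) P := by
    intro i
    refine Integrable.of_bound (hm.comp (measurable_pi_apply i)).aestronglyMeasurable 1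
      (Filter.Eventually.of_forall fun ω => ?_)
    by_cases h : ω i ∈ s <;> simp [h]
  have hmean : ∫ ω, r * (a - ∑ i, s.indicator 1 (ω i)) ∂P = r * (a - n * p.real s) := by
    rw [integral_const_mul,
      integral_sub (integrable_const _) (integrable_finsetSum _ fun i _ => hii i),
      integral_finsetSum _ fun i _ => hii i]
    simp_rw [P, integral_comp_eval (μ := fun _ : Fin n => p) hm.aestronglyMeasurable,
      integral_indicator_one hs]
    simp
  rw [hmean] at hJ
  rw [← ofReal_integral_eq_lintegral_ofReal hie
    (Filter.Eventually.of_forall fun _ => (Real.exp_pos _).le)]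
  exact ENNReal.ofReal_le_ofReal hJ

lemma ShattersAtMost.lintegral_le {X ι : Type*} [MeasurableSpace X] [Nonempty ι] [Countable ι]
    {H : ι → Set X} (hmeas : ∀ j, MeasurableSet (H j)) {D n : ℕ}
    (hD : 1 ≤ D) (hH : ShattersAtMost H D n) (p : Measure X) [IsProbabilityMeasure p] (r : ℝ) :
    ∫⁻ ω, ⨆ j, ENNReal.ofReal (Real.exp (r * (∑ i, (H j).indicator 1 (ω i) - n * p.real (H j))))
        ∂(Measure.pi fun _ : Fin n => p)
      ≤ ENNReal.ofReal (Real.exp (20 * D + 16 * r ^ 2 * n)) := by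
  have hm := fun j => measurable_indicator_one (hmeas j)
  have hmeasF : Measurable fun q : (Fin n → X) × (Fin n → X) => ⨆ j, ENNReal.ofReal
      (Real.exp (r * (∑ i, (H j).indicator 1 (q.1 i) - ∑ i, (H j).indicator 1 (q.2 i)))) := by
    refine Measurable.iSup fun j => ?_
    have := hm j
    fun_prop
  calc _ ≤ ∫⁻ ω, ∫⁻ ω', ⨆ j, ENNReal.ofReal (Real.exp
            (r * (∑ i, (H j).indicator 1 (ω i) - ∑ i, (H j).indicator 1 (ω' i))))
          ∂(Measure.pi fun _ : Fin n => p) ∂(Measure.pi fun _ : Fin n => p) := by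
        refine lintegral_mono fun ω => iSup_le fun j => ?_
        refine (exp_mul_sub_le_lintegral (hmeas j) n p r _).trans (lintegral_mono fun ω' => ?_)
        exact le_iSup (fun j => ENNReal.ofReal (Real.exp
            (r * (∑ i, (H j).indicator 1 (ω i) - ∑ i, (H j).indicator 1 (ω' i))))) j
    _ = _ := (lintegral_prod _ hmeasF.aemeasurable).symm
    _ = _ := ((measurePreserving_arrowProdEquivProdArrow X X (Fin n) (fun _ => p)
          (fun _ => p)).lintegral_comp hmeasF).symm
    _ ≤ _ := by
        refine le_trans (le_of_eq (lintegral_congr fun z => iSup_congr fun j => ?_))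
          (hH.lintegral_pair_le hmeas hD p r)
        rw [Finset.sum_sub_distrib]
        rfl

/-- One-sided uniform deviation bound for a countable set system of bounded VC dimension. -/
lemma ShattersAtMost.measure_deviation_le {X ι : Type*} [MeasurableSpace X] [Nonempty ι]
    [Countable ι] {H : ι → Set X} (hmeas : ∀ j, MeasurableSet (H j)) {D n : ℕ}
    (hD : 1 ≤ D) (hH : ShattersAtMost H D n) (p : Measure X) [IsProbabilityMeasure p] (r u : ℝ) :
    (Measure.pi fun _ : Fin n => p)
        {ω | ∃ j, u ≤ r * (∑ i, (H j).indicator 1 (ω i) - n * p.real (H j))}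
      ≤ ENNReal.ofReal (Real.exp (20 * D + 16 * r ^ 2 * n - u)) := by
  have hm := fun j => measurable_indicator_one (hmeas j)
  have hmeasF : Measurable fun ω : Fin n → X => ⨆ j, ENNReal.ofReal
      (Real.exp (r * (∑ i, (H j).indicator 1 (ω i) - n * p.real (H j)))) := by
    refine Measurable.iSup fun j => ?_
    have := hm j
    fun_prop
  have h := (mul_meas_ge_le_lintegral (μ := Measure.pi fun _ : Fin n => p) hmeasF
    (ENNReal.ofReal (Real.exp u))).trans (hH.lintegral_le hmeas hD p r)
  rw [Real.exp_sub, ENNReal.ofReal_div_of_pos (Real.exp_pos _),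
    ENNReal.le_div_iff_mul_le (by simp [Real.exp_pos]) (by simp), mul_comm]
  refine le_trans (mul_le_mul_right (measure_mono ?_) _) h
  rintro ω ⟨j, hj⟩
  exact (ENNReal.ofReal_le_ofReal (Real.exp_le_exp.2 hj)).trans (le_iSup (fun j => ENNReal.ofReal
      (Real.exp (r * (∑ i, (H j).indicator 1 (ω i) - n * p.real (H j))))) j)

/-- Halfspaces of `ℝ^d` shatter at most `d + 1` points. -/
lemma shattersAtMost_halfspace {d : ℕ} {ι : Type*} (q : ι → Euc d × ℝ) (n : ℕ) :
    ShattersAtMost (fun j => {x | (q j).2 ≤ ⟪(q j).1, x⟫}) (d + 1) n := by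
  classical
  intro x B hB
  by_contra hcard
  have hdep : ¬ AffineIndependent ℝ fun i : B => x i := by
    intro h
    have h1 := h.card_le_finrank_succ
    have h2 := Submodule.finrank_le (vectorSpan ℝ (Set.range fun i : B => x i))
    rw [finrank_euclideanSpace_fin] at h2
    rw [Fintype.card_coe] at h1
    omega
  obtain ⟨I, y, hy1, hy2⟩ := Convex.radon_partition hdep
  obtain ⟨j, hj⟩ := hB (B.filter fun i => ∃ h : i ∈ B, (⟨i, h⟩ : B) ∈ I) (Finset.filter_subset _ _)
  have hlin : IsLinearMap ℝ fun z : Euc d => ⟪(q j).1, z⟫ := (innerₛₗ ℝ (q j).1).isLinear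
  have h1 : y ∈ {z : Euc d | (q j).2 ≤ ⟪(q j).1, z⟫} := by
    refine convexHull_min ?_ (convex_halfSpace_ge hlin _) hy1
    rintro _ ⟨i, hi, rfl⟩
    exact (hj i i.2).2 (by simp [hi])
  have h2 : y ∈ {z : Euc d | ⟪(q j).1, z⟫ < (q j).2} := by
    refine convexHull_min ?_ (convex_halfSpace_lt hlin _) hy2
    rintro _ ⟨i, hi, rfl⟩
    have hni : (i : Fin n) ∉ B.filter fun i => ∃ h : i ∈ B, (⟨i, h⟩ : B) ∈ I := by
      simpa using hi
    have hnot : ¬ (q j).2 ≤ ⟪(q j).1, x i⟫ := mt (hj i i.2).1 hni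
    exact not_le.1 hnot
  simp only [Set.mem_ofPred_eq] at h1 h2
  linarith

lemma measurableSet_halfspace {d : ℕ} (v : Euc d) (t : ℝ) :
    MeasurableSet {x : Euc d | t ≤ ⟪v, x⟫} :=
  measurableSet_le measurable_const (by fun_prop)

/-- Every closed halfspace is a pointwise limit of members of a fixed countable family. -/
lemma exists_tendsto_denseSeq_halfspace {d : ℕ} (v : Euc d) (t : ℝ) :
    ∃ m : ℕ → ℕ, ∀ x : Euc d, ∀ᶠ k in Filter.atTop,
      (x ∈ {x : Euc d | (TopologicalSpace.denseSeq (Euc d × ℝ) (m k)).2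
          ≤ ⟪(TopologicalSpace.denseSeq (Euc d × ℝ) (m k)).1, x⟫}
        ↔ x ∈ {x : Euc d | t ≤ ⟪v, x⟫}) := by
  set s : ℕ → ℝ := fun k => 1 / ((k : ℝ) + 1) with hs
  have hs0 : ∀ k, 0 < s k := fun k => by simp only [hs]; positivity
  have hst : Filter.Tendsto s Filter.atTop (nhds 0) := tendsto_one_div_add_atTop_nhds_zero_nat
  have hex : ∀ k, ∃ i, dist (v, t - s k) (TopologicalSpace.denseSeq (Euc d × ℝ) i)
      < s k * s k / 4 := fun k =>
    (TopologicalSpace.denseRange_denseSeq (Euc d × ℝ)).exists_dist_lt _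
      (by have := hs0 k; positivity)
  choose m hm using hex
  refine ⟨m, fun x => ?_⟩
  have e1 : ∀ᶠ k in Filter.atTop, s k * (‖x‖ + 1) < 1 := by
    have : Filter.Tendsto (fun k => s k * (‖x‖ + 1)) Filter.atTop (nhds 0) := by
      simpa using hst.mul_const (‖x‖ + 1)
    exact this.eventually_lt_const one_pos
  have e2 : ∀ᶠ k in Filter.atTop, t ≤ ⟪v, x⟫ ∨ ⟪v, x⟫ < t - 2 * s k := by
    by_cases h : t ≤ ⟪v, x⟫
    · exact Filter.Eventually.of_forall fun _ => Or.inl h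
    · have : Filter.Tendsto (fun k => t - 2 * s k) Filter.atTop (nhds t) := by
        simpa using (hst.const_mul 2).const_sub t
      exact (this.eventually_const_lt (not_le.1 h)).mono fun k hk => Or.inr hk
  filter_upwards [e1, e2] with k h1 h2
  set q := TopologicalSpace.denseSeq (Euc d × ℝ) (m k) with hq
  have hk := hm k
  rw [← hq, Prod.dist_eq, max_lt_iff, dist_eq_norm, Real.dist_eq] at hk
  have hin : |⟪v, x⟫ - ⟪q.1, x⟫| ≤ s k * s k / 4 * ‖x‖ := by
    rw [← inner_sub_left]
    exact (abs_real_inner_le_norm _ _).trans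
      (mul_le_mul_of_nonneg_right hk.1.le (norm_nonneg _))
  have hk2 := abs_lt.1 hk.2
  have hin2 := abs_le.1 hin
  have hsk := hs0 k
  have hx := norm_nonneg x
  have hprod : s k * (s k * (‖x‖ + 1)) ≤ s k * 1 := mul_le_mul_of_nonneg_left h1.le hsk.le
  have hsq : 0 ≤ s k * s k * ‖x‖ := by positivity
  have hsq' : 0 ≤ s k * s k := by positivity
  change _ ≤ _ ↔ _ ≤ _
  constructor
  · intro h
    rcases h2 with h2 | h2
    · exact h2
    · exfalso; nlinarith
  · intro h
    nlinarith

/-- The empirical measure of the sample `ω`. -/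
def empiricalMeasure {X : Type*} [MeasurableSpace X] {n : ℕ} (ω : Fin n → X) : Measure X :=
  (n : ℝ≥0∞)⁻¹ • ∑ i : Fin n, Measure.dirac (ω i)

lemma isProbabilityMeasure_empiricalMeasure {X : Type*} [MeasurableSpace X] {n : ℕ} (hn : 1 ≤ n)
    (ω : Fin n → X) : IsProbabilityMeasure (empiricalMeasure ω) := by
  constructor
  simp only [empiricalMeasure, Measure.smul_apply, Measure.coe_finsetSum, Finset.sum_apply,
    measure_univ, Finset.sum_const, Finset.card_univ, Fintype.card_fin, nsmul_eq_mul, mul_one,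
    smul_eq_mul]
  exact ENNReal.inv_mul_cancel (by simpa using by omega) (by simp)

lemma empiricalMeasure_real {X : Type*} [MeasurableSpace X] {n : ℕ} (ω : Fin n → X) {s : Set X}
    (hs : MeasurableSet s) :
    (empiricalMeasure ω).real s = (∑ i, s.indicator 1 (ω i)) / n := by
  simp only [Measure.real, empiricalMeasure, Measure.smul_apply, Measure.coe_finsetSum,
    Finset.sum_apply, Measure.dirac_apply' _ hs, smul_eq_mul, ENNReal.toReal_mul,
    ENNReal.toReal_inv, ENNReal.toReal_natCast]
  rw [ENNReal.toReal_sum fun i _ => by by_cases h : ω i ∈ s <;> simp [h], div_eq_inv_mul]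
  congr 2
  ext i
  by_cases h : ω i ∈ s <;> simp [h]

lemma abs_measure_halfspace_sub_le_of_denseSeq {d : ℕ} {μ ν : Measure (Euc d)}
    [IsFiniteMeasure μ] [IsFiniteMeasure ν] {Δ : ℝ}
    (h : ∀ k, |μ.real {x : Euc d | (TopologicalSpace.denseSeq (Euc d × ℝ) k).2
          ≤ ⟪(TopologicalSpace.denseSeq (Euc d × ℝ) k).1, x⟫}
        - ν.real {x : Euc d | (TopologicalSpace.denseSeq (Euc d × ℝ) k).2
          ≤ ⟪(TopologicalSpace.denseSeq (Euc d × ℝ) k).1, x⟫}| ≤ Δ) (v : Euc d) (t : ℝ) :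
    |μ.real {x : Euc d | t ≤ ⟪v, x⟫} - ν.real {x : Euc d | t ≤ ⟪v, x⟫}| ≤ Δ := by
  obtain ⟨m, hm⟩ := exists_tendsto_denseSeq_halfspace v t
  have hlim : ∀ ρ : Measure (Euc d), IsFiniteMeasure ρ → Filter.Tendsto
      (fun k => ρ.real {x : Euc d | (TopologicalSpace.denseSeq (Euc d × ℝ) (m k)).2
          ≤ ⟪(TopologicalSpace.denseSeq (Euc d × ℝ) (m k)).1, x⟫}) Filter.atTop
      (nhds (ρ.real {x : Euc d | t ≤ ⟪v, x⟫})) := fun ρ _ =>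
    (ENNReal.tendsto_toReal (measure_ne_top _ _)).comp
      (tendsto_measure_of_tendsto_indicator_of_isFiniteMeasure Filter.atTop ρ
        (fun k => measurableSet_halfspace _ _) hm)
  exact le_of_tendsto ((hlim μ inferInstance).sub (hlim ν inferInstance)).abs
    (Filter.Eventually.of_forall fun k => h (m k))

/-- Uniform convergence of the empirical measure over closed halfspaces, at the rate without
logarithmic factors. -/
lemma measure_uniform_deviation_halfspace_ge {d : ℕ} (p : Measure (Euc d)) [IsProbabilityMeasure p]
    {δ : ℝ} (hδ : 0 < δ) (hδ1 : δ < 1) {n : ℕ} (hn : 1 ≤ n) :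
    ENNReal.ofReal (1 - δ) ≤ (Measure.pi fun _ : Fin n => p) {ω | ∀ (v : Euc d) (t : ℝ),
      |(empiricalMeasure ω).real {x | t ≤ ⟪v, x⟫} - p.real {x | t ≤ ⟪v, x⟫}|
        ≤ 40 * Real.sqrt ((d + 1 + Real.log (1 / δ)) / n)} := by
  set P := Measure.pi fun _ : Fin n => p with hP
  set Δ := 40 * Real.sqrt ((d + 1 + Real.log (1 / δ)) / n) with hΔ
  have hn0 : (0 : ℝ) < n := by exact_mod_cast hn
  have hL : 0 < Real.log (1 / δ) := Real.log_pos (by rw [lt_div_iff₀ hδ]; linarith)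
  have hΔ0 : 0 < Δ := by positivity
  have hΔ2 : n * Δ ^ 2 = 1600 * (d + 1 + Real.log (1 / δ)) := by
    rw [hΔ, mul_pow, Real.sq_sqrt (by positivity)]
    field_simp
    norm_num
  set q : ℕ → Euc d × ℝ := TopologicalSpace.denseSeq (Euc d × ℝ) with hq
  set H : ℕ → Set (Euc d) := fun j => {x | (q j).2 ≤ ⟪(q j).1, x⟫} with hH
  have hmeas : ∀ j, MeasurableSet (H j) := fun j => measurableSet_halfspace _ _
  let bad : ℝ → Set (Fin n → Euc d) := fun r =>
    {ω | ∃ j, n * Δ ^ 2 / 32 ≤ r * (∑ i, (H j).indicator 1 (ω i) - n * p.real (H j))}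
  have hbad : ∀ r, r ^ 2 = (Δ / 32) ^ 2 → P (bad r) ≤ ENNReal.ofReal (δ / 2) := by
    intro r hr
    refine ((shattersAtMost_halfspace q n).measure_deviation_le hmeas (by omega) p r _).trans
      (ENNReal.ofReal_le_ofReal ?_)
    rw [← Real.le_log_iff_exp_le (by positivity), Real.log_div hδ.ne' two_ne_zero, hr]
    have h2 := Real.log_two_lt_d9
    rw [one_div, Real.log_inv] at hΔ2 hL
    have : (0 : ℝ) ≤ d := by positivity
    push_cast
    nlinarith
  have hgood : (bad (Δ / 32) ∪ bad (-(Δ / 32)))ᶜ ⊆ {ω | ∀ (v : Euc d) (t : ℝ),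
      |(empiricalMeasure ω).real {x | t ≤ ⟪v, x⟫} - p.real {x | t ≤ ⟪v, x⟫}| ≤ Δ} := by
    intro ω hω v t
    have := isProbabilityMeasure_empiricalMeasure hn ω
    refine abs_measure_halfspace_sub_le_of_denseSeq (fun k => ?_) v t
    change |(empiricalMeasure ω).real (H k) - p.real (H k)| ≤ Δ
    simp only [bad, Set.mem_compl_iff, Set.mem_union, Set.mem_ofPred_eq, not_or, not_exists,
      not_le] at hω
    have h1 := hω.1 k
    have h2 := hω.2 k
    rw [empiricalMeasure_real ω (hmeas k)]
    set A := ∑ i, (H k).indicator (1 : Euc d → ℝ) (ω i)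
    have e : A / n - p.real (H k) = (A - n * p.real (H k)) / n := by field_simp
    rw [e, abs_div, abs_of_pos hn0, div_le_iff₀ hn0, abs_le]
    constructor <;> nlinarith
  have hPbad : P (bad (Δ / 32) ∪ bad (-(Δ / 32))) ≤ ENNReal.ofReal δ := by
    refine (measure_union_le _ _).trans ((add_le_add (hbad _ rfl) (hbad _ (by ring))).trans ?_)
    rw [← ENNReal.ofReal_add (by positivity) (by positivity), add_halves]
  refine le_trans ?_ (measure_mono hgood)
  rw [ENNReal.ofReal_sub _ hδ.le, ENNReal.ofReal_one, tsub_le_iff_right]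
  calc (1 : ℝ≥0∞) = P Set.univ := measure_univ.symm
    _ = P ((bad (Δ / 32) ∪ bad (-(Δ / 32)))ᶜ ∪ (bad (Δ / 32) ∪ bad (-(Δ / 32)))) := by
        rw [Set.compl_union_self]
    _ ≤ _ := (measure_union_le _ _).trans (add_le_add le_rfl hPbad)

lemma measureReal_sub_le_tvDist {d : ℕ} (p q : Measure (Euc d)) [IsProbabilityMeasure p]
    {A : Set (Euc d)} (hA : MeasurableSet A) : p.real A - q.real A ≤ tvDist p q := by
  refine le_ciSup (f := fun A : {A : Set (Euc d) // MeasurableSet A} =>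
    (p A).toReal - (q A).toReal) ⟨1, ?_⟩ ⟨A, hA⟩
  rintro _ ⟨B, rfl⟩
  have h1 : p.real (B : Set (Euc d)) ≤ 1 := measureReal_le_one
  have h2 : 0 ≤ q.real (B : Set (Euc d)) := measureReal_nonneg
  simp only [Measure.real] at h1 h2
  simp only
  linarith

lemma measureReal_le_decay {d : ℕ} (p : Measure (Euc d)) [IsProbabilityMeasure p] (μ : Euc d)
    (t : ℝ) {v : Euc d} (hv : ‖v‖ ≤ 1) : p.real {x | t < ⟪v, x - μ⟫} ≤ decay p μ t := by
  refine le_ciSup (f := fun v : {v : Euc d // ‖v‖ ≤ 1} =>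
    (p {x | t < ⟪(v : Euc d), x - μ⟫}).toReal) ⟨1, ?_⟩ ⟨v, hv⟩
  rintro _ ⟨u, rfl⟩
  exact measureReal_le_one

/-- **Theorem 3, finite-sample Tukey median under oblivious TV
corruption.** There is a universal constant `C > 0` such that: for any `d ≥ 1`,
any halfspace-symmetric `p*` with center `μ*` and decay function `h`, any `p`
with `TV(p, p*) ≤ ε`, any `δ ∈ (0,1)` and any `n ≥ 1` i.i.d. samples from `p`
with empirical measure `p̂ₙ`, setting `ε̃ = ε + C √((d + 1 + log(1/δ))/n)`, with
probability at least `1 − δ` every Tukey median `μ̂` of `p̂ₙ` satisfies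
`‖μ̂ − μ*‖ ≤ t` for every `t ≥ 0` with `h(t) < 1 − h(0) − 2ε̃`. -/
theorem finite_sample_tukey_median :
    ∃ C : ℝ, 0 < C ∧
      ∀ (d : ℕ), 1 ≤ d →
      ∀ (pstar p : Measure (Euc d)),
        IsProbabilityMeasure pstar → IsProbabilityMeasure p →
      ∀ (μstar : Euc d), IsHalfspaceSymmetric pstar μstar →
      ∀ (ε : ℝ), tvDist p pstar ≤ ε →
      ∀ (δ : ℝ), 0 < δ → δ < 1 →
      ∀ (n : ℕ), 1 ≤ n →
        ENNReal.ofReal (1 - δ) ≤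
          (Measure.pi fun _ : Fin n => p)
            {ω : Fin n → Euc d |
              ∀ μhat : Euc d,
                IsTukeyMedian μhat
                  ((n : ℝ≥0∞)⁻¹ • ∑ i : Fin n, Measure.dirac (ω i)) →
                ∀ t : ℝ, 0 ≤ t →
                  decay pstar μstar t <
                    1 - decay pstar μstar 0 -
                      2 * (ε + C * Real.sqrt ((d + 1 + Real.log (1 / δ)) / n)) →
                  ‖μhat - μstar‖ ≤ t} := by
  refine ⟨40, by norm_num, ?_⟩
  intro d hd pstar p _ _ μstar _ ε hε δ hδ hδ1 n hn
  refine (measure_uniform_deviation_halfspace_ge p hδ hδ1 hn).trans (measure_mono ?_)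
  intro ω hω μhat hmed t ht hdec
  set Δ := 40 * Real.sqrt ((d + 1 + Real.log (1 / δ)) / n)
  change IsTukeyMedian μhat (empiricalMeasure ω) at hmed
  have := isProbabilityMeasure_empiricalMeasure hn ω
  have hTV : ∀ A, MeasurableSet A → p.real A - pstar.real A ≤ ε := fun A hA =>
    (measureReal_sub_le_tvDist p pstar hA).trans hε
  by_contra! hlt
  have hr : 0 < ‖μhat - μstar‖ := ht.trans_lt hlt
  have hlower : 1 - decay pstar μstar 0 - ε - Δ ≤ tukeyDepth μstar (empiricalMeasure ω) := by
    have hne : Nonempty {v : Euc d // v ≠ 0} :=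
      ⟨⟨μhat - μstar, norm_pos_iff.1 hr⟩⟩
    refine le_ciInf fun ⟨v, hv⟩ => ?_
    have h1 := abs_le.1 (hω v ⟪v, μstar⟫)
    have hmeas := measurableSet_halfspace v ⟪v, μstar⟫
    have h2 := hTV _ hmeas.compl
    have h3 := probReal_compl_eq_one_sub (μ := p) hmeas
    have h4 : pstar.real {x : Euc d | ⟪v, μstar⟫ ≤ ⟪v, x⟫}ᶜ ≤ decay pstar μstar 0 := by
      refine le_trans (measureReal_mono fun x hx => ?_)
        (measureReal_le_decay pstar μstar 0 (v := -(‖v‖⁻¹ • v)) ?_)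
      · have hx' : ⟪v, x⟫ < ⟪v, μstar⟫ := lt_of_not_ge hx
        have hv' : 0 < ‖v‖⁻¹ := inv_pos.2 (norm_pos_iff.2 hv)
        change 0 < ⟪-(‖v‖⁻¹ • v), x - μstar⟫
        rw [inner_neg_left, real_inner_smul_left, inner_sub_right]
        nlinarith
      · rw [norm_neg, norm_smul, norm_inv, norm_norm,
          inv_mul_cancel₀ (norm_ne_zero_iff.2 hv)]
    change _ ≤ (empiricalMeasure ω).real {x | 0 ≤ ⟪v, x - μstar⟫}
    simp_rw [inner_sub_right, sub_nonneg]
    linarith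
  have hupper : tukeyDepth μhat (empiricalMeasure ω) ≤ decay pstar μstar t + ε + Δ := by
    set v := μhat - μstar with hv
    have hbdd : BddBelow (Set.range fun u : {v : Euc d // v ≠ 0} =>
        (empiricalMeasure ω {x | 0 ≤ ⟪(u : Euc d), x - μhat⟫}).toReal) :=
      ⟨0, by rintro _ ⟨u, rfl⟩; exact ENNReal.toReal_nonneg⟩
    refine (ciInf_le hbdd ⟨v, norm_pos_iff.1 hr⟩).trans ?_
    change (empiricalMeasure ω).real {x | 0 ≤ ⟪v, x - μhat⟫} ≤ _
    simp_rw [inner_sub_right, sub_nonneg]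
    have h1 := abs_le.1 (hω v ⟪v, μhat⟫)
    have h2 := hTV _ (measurableSet_halfspace v ⟪v, μhat⟫)
    have h4 : pstar.real {x : Euc d | ⟪v, μhat⟫ ≤ ⟪v, x⟫} ≤ decay pstar μstar t := by
      refine le_trans (measureReal_mono fun x hx => ?_)
        (measureReal_le_decay pstar μstar t (v := ‖v‖⁻¹ • v) ?_)
      · have hx' : ⟪v, μhat⟫ ≤ ⟪v, x⟫ := hx
        change t < ⟪‖v‖⁻¹ • v, x - μstar⟫
        have h5 : ‖v‖ * ‖v‖ ≤ ⟪v, x - μstar⟫ := by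
          rw [← real_inner_self_eq_norm_mul_norm]
          nth_rewrite 3 [hv]
          rw [inner_sub_right, inner_sub_right]
          linarith
        rw [real_inner_smul_left]
        refine hlt.trans_le ?_
        rw [← div_eq_inv_mul, le_div_iff₀ hr]
        exact h5
      · rw [norm_smul, norm_inv, norm_norm, inv_mul_cancel₀ hr.ne']
    linarith
  have := hmed μstar
  linarith

end
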